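/- arXiv:2405.15621 — 2 statements merged into one kernel-verified Lean document; each statement's English description precedes it below -/
import Mathlib

section
/- Let m > 0, T > 0, ℓ, λ, ν, μ ∈ ℝ, and let k : ℝ → ℝ be continuous and T-periodic. Let f, g, h : ℝ → ℂ be twice continuously differentiable and T-periodic, with ∫₀ᵀ |f(t)|² dt = 1. Assume that for all t: −m(f'' + 2iℓ f' − ℓ² f) − k f = λ f; −m(g'' + 2iℓ g' − ℓ² g) − k g − λ g = 2im(f' + iℓ f) + ν f; and −m(h'' + 2iℓ h' − ℓ² h) − k h − λ h = 4im(g' + iℓ g) + 2ν g + (μ − 2m) f. Then μ = 2m − 2ν ∫₀ᵀ conj(f(t)) g(t) dt − 4im ∫₀ᵀ conj(f(t)) (g'(t) + iℓ g(t)) dt (an equality of complex numbers, whose right-hand side is in fact real). -/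
open Complex intervalIntegral

/-- The derivative of a periodic function is periodic. -/
theorem deriv_add_period {u : ℝ → ℂ} {T : ℝ} (hu : ∀ t, u (t + T) = u t) (t : ℝ) :
    deriv u (t + T) = deriv u t := by
  rw [← deriv_comp_add_const, funext hu]

/-- Fredholm solvability condition: the right-hand side of an inhomogeneous Bloch equation
is orthogonal over a period to every periodic solution of the homogeneous one. -/
theorem integral_conj_mul_eq_zero_of_bloch (m T ℓ lam : ℝ) (k : ℝ → ℝ) (f h r : ℝ → ℂ)
    (hf : ContDiff ℝ 2 f) (hh : ContDiff ℝ 2 h) (hr : Continuous r)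
    (hfper : ∀ t, f (t + T) = f t) (hhper : ∀ t, h (t + T) = h t)
    (hfeq : ∀ t : ℝ,
      -(m : ℂ) * (deriv (deriv f) t + 2 * Complex.I * (ℓ : ℂ) * deriv f t
          - (ℓ : ℂ) ^ 2 * f t) - (k t : ℂ) * f t = (lam : ℂ) * f t)
    (hheq : ∀ t : ℝ,
      -(m : ℂ) * (deriv (deriv h) t + 2 * Complex.I * (ℓ : ℂ) * deriv h t
          - (ℓ : ℂ) ^ 2 * h t) - (k t : ℂ) * h t - (lam : ℂ) * h t = r t) :
    ∫ t in (0 : ℝ)..T, (starRingEnd ℂ) (f t) * r t = 0 := by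
  have hasDeriv {u : ℝ → ℂ} (hu : ContDiff ℝ 2 u) (t : ℝ) :
      HasDerivAt u (deriv u t) t ∧ HasDerivAt (deriv u) (deriv (deriv u) t) t :=
    ⟨(hu.differentiable (by norm_num) t).hasDerivAt,
      ((hu.deriv' (n := 1)).differentiable (by norm_num) t).hasDerivAt⟩
  have hW (t : ℝ) : HasDerivAt
      (fun t => -(m : ℂ) * (star (f t) * deriv h t - star (deriv f t) * h t
        + 2 * Complex.I * ℓ * (star (f t) * h t)))
      ((starRingEnd ℂ) (f t) * r t) t := by
    obtain ⟨hf₁, hf₂⟩ := hasDeriv hf t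
    obtain ⟨hh₁, hh₂⟩ := hasDeriv hh t
    refine HasDerivAt.congr_deriv ((((hf₁.star.mul hh₂).sub (hf₂.star.mul hh₁)).add
      ((hf₁.star.mul hh₁).const_mul (2 * Complex.I * (ℓ : ℂ)))).const_mul (-(m : ℂ))) ?_
    have hconj := congrArg (starRingEnd ℂ) (hfeq t)
    simp only [map_sub, map_mul, map_neg, map_add, map_pow, Complex.conj_ofReal, Complex.conj_I,
      map_ofNat] at hconj
    simp only [← hheq t, ← starRingEnd_apply]
    linear_combination (-h t) * hconj
  rw [integral_eq_sub_of_hasDerivAt (fun t _ => hW t)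
    ((Complex.continuous_conj.comp hf.continuous).mul hr |>.intervalIntegrable _ _)]
  have hf₀ := hfper 0
  have hh₀ := hhper 0
  have hf₁ := deriv_add_period hfper 0
  have hh₁ := deriv_add_period hhper 0
  rw [zero_add] at hf₀ hh₀ hf₁ hh₁
  rw [hf₀, hh₀, hf₁, hh₁, sub_self]

/-- Projecting the twice ℓ-differentiated Bloch equation onto the normalized
Bloch eigenfunction `f` yields the band-curvature formula
`μ = λ''(ℓ) = 2m − 2ν⟨f, g⟩ − 4im⟨f, g' + iℓg⟩` with `g = ∂_ℓ f`. -/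
theorem stmt_17 (m T ℓ lam ν μ : ℝ) (hm : 0 < m) (hT : 0 < T)
    (k : ℝ → ℝ) (hkcont : Continuous k) (hkper : ∀ t : ℝ, k (t + T) = k t)
    (f g h : ℝ → ℂ) (hf : ContDiff ℝ 2 f) (hg : ContDiff ℝ 2 g) (hh : ContDiff ℝ 2 h)
    (hfper : ∀ t : ℝ, f (t + T) = f t) (hgper : ∀ t : ℝ, g (t + T) = g t)
    (hhper : ∀ t : ℝ, h (t + T) = h t)
    (hnorm : ∫ t in (0 : ℝ)..T, ‖f t‖ ^ 2 = 1)
    (hfeq : ∀ t : ℝ,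
      -(m : ℂ) * (deriv (deriv f) t + 2 * Complex.I * (ℓ : ℂ) * deriv f t
          - (ℓ : ℂ) ^ 2 * f t) - (k t : ℂ) * f t = (lam : ℂ) * f t)
    (hgeq : ∀ t : ℝ,
      -(m : ℂ) * (deriv (deriv g) t + 2 * Complex.I * (ℓ : ℂ) * deriv g t
          - (ℓ : ℂ) ^ 2 * g t) - (k t : ℂ) * g t - (lam : ℂ) * g t =
        2 * Complex.I * (m : ℂ) * (deriv f t + Complex.I * (ℓ : ℂ) * f t)
          + (ν : ℂ) * f t)
    (hheq : ∀ t : ℝ,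
      -(m : ℂ) * (deriv (deriv h) t + 2 * Complex.I * (ℓ : ℂ) * deriv h t
          - (ℓ : ℂ) ^ 2 * h t) - (k t : ℂ) * h t - (lam : ℂ) * h t =
        4 * Complex.I * (m : ℂ) * (deriv g t + Complex.I * (ℓ : ℂ) * g t)
          + 2 * (ν : ℂ) * g t + ((μ : ℂ) - 2 * (m : ℂ)) * f t) :
    (μ : ℂ) = 2 * (m : ℂ)
      - 2 * (ν : ℂ) * (∫ t in (0 : ℝ)..T, (starRingEnd ℂ) (f t) * g t)
      - 4 * Complex.I * (m : ℂ) *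
        ∫ t in (0 : ℝ)..T, (starRingEnd ℂ) (f t) * (deriv g t + Complex.I * (ℓ : ℂ) * g t) := by
  have hfc := hf.continuous
  have hgc := hg.continuous
  have hg'c : Continuous (deriv g) := hg.continuous_deriv (by norm_num)
  have hconj : Continuous fun t => (starRingEnd ℂ) (f t) := Complex.continuous_conj.comp hfc
  have key := integral_conj_mul_eq_zero_of_bloch m T ℓ lam k f h _ hf hh
    (by fun_prop) hfper hhper hfeq hheq
  have hff : ∫ t in (0 : ℝ)..T, (starRingEnd ℂ) (f t) * f t = 1 := by
    simp only [Complex.conj_mul']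
    simpa only [← Complex.ofReal_pow, integral_ofReal, Complex.ofReal_one] using
      congrArg Complex.ofReal hnorm
  have hexp : (fun t => (starRingEnd ℂ) (f t) *
        (4 * Complex.I * (m : ℂ) * (deriv g t + Complex.I * (ℓ : ℂ) * g t)
          + 2 * (ν : ℂ) * g t + ((μ : ℂ) - 2 * (m : ℂ)) * f t)) =
      fun t => 4 * Complex.I * (m : ℂ) *
          ((starRingEnd ℂ) (f t) * (deriv g t + Complex.I * (ℓ : ℂ) * g t))
        + 2 * (ν : ℂ) * ((starRingEnd ℂ) (f t) * g t)
        + ((μ : ℂ) - 2 * (m : ℂ)) * ((starRingEnd ℂ) (f t) * f t) := by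
    funext t
    ring
  rw [hexp, integral_add (Continuous.intervalIntegrable (by fun_prop) _ _)
      (Continuous.intervalIntegrable (by fun_prop) _ _),
    integral_add (Continuous.intervalIntegrable (by fun_prop) _ _)
      (Continuous.intervalIntegrable (by fun_prop) _ _),
    integral_const_mul, integral_const_mul, integral_const_mul, hff] at key
  linear_combination key
end

section
/- Let s₁ > 0, s₂ > 0, s₃ > 0. Then there exists a nonconstant twice continuously differentiable function A : ℝ → ℝ solving A''(t) + s₃·A'(t) = s₁·A(t) − s₂·A(t)³ for all t ∈ ℝ, such that (A(t), A'(t)) → (0, 0) as t → −∞ and (A(t), A'(t)) → (sqrt(s₁/s₂), 0) as t → +∞. -/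
open Filter Set Topology
open scoped NNReal

/-- An autonomous ODE with a bounded Lipschitz vector field has global solutions. -/
theorem exists_global_solution_of_lipschitzWith_of_bounded {E : Type*} [NormedAddCommGroup E]
    [NormedSpace ℝ E] [CompleteSpace E] {f : E → E} {K L : ℝ≥0} (hK : LipschitzWith K f)
    (hL : ∀ x, ‖f x‖ ≤ L) (x₀ : E) :
    ∃ α : ℝ → E, α 0 = x₀ ∧ ∀ t, HasDerivAt α (f (α t)) t := by
  have local_sol : ∀ n : ℕ, ∃ α : ℝ → E, α 0 = x₀ ∧
      ∀ t ∈ Ioo (-((n : ℝ) + 1)) (n + 1), HasDerivAt α (f (α t)) t := by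
    intro n
    have hn : (0 : ℝ) ≤ n := n.cast_nonneg
    have hPL : IsPicardLindelof (fun _ : ℝ => f) (tmin := -((n : ℝ) + 1)) (tmax := n + 1)
        ⟨0, by constructor <;> linarith⟩ x₀ (L * (n + 1)) 0 L K := by
      refine .of_time_independent (fun x _ => hL x) hK.lipschitzOnWith ?_
      simp
    obtain ⟨α, h0, hα⟩ := hPL.exists_eq_forall_mem_Icc_hasDerivWithinAt₀
    exact ⟨α, h0, fun t ht =>
      (hα t (Ioo_subset_Icc_self ht)).hasDerivAt (Icc_mem_nhds ht.1 ht.2)⟩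
  choose α hα0 hα using local_sol
  have agree : ∀ (m n : ℕ) (t : ℝ), |t| < m + 1 → |t| < n + 1 → α m t = α n t := by
    intro m n t hm hn
    have hm0 : (0 : ℝ) ≤ m := m.cast_nonneg
    have hn0 : (0 : ℝ) ≤ n := n.cast_nonneg
    have hsub : ∀ s ∈ Ioo (-min ((m : ℝ) + 1) (n + 1)) (min ((m : ℝ) + 1) (n + 1)),
        s ∈ Ioo (-((m : ℝ) + 1)) (m + 1) ∧ s ∈ Ioo (-((n : ℝ) + 1)) (n + 1) := by
      intro s hs
      simp only [mem_Ioo] at *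
      grind
    refine ODE_solution_unique_of_mem_Ioo (v := fun _ => f) (s := fun _ => univ) (t₀ := 0)
      (fun _ _ => hK.lipschitzOnWith) ?_ (fun s hs => ⟨hα m s (hsub s hs).1, trivial⟩)
      (fun s hs => ⟨hα n s (hsub s hs).2, trivial⟩) (by rw [hα0, hα0]) ?_
    · simp only [mem_Ioo]; grind
    · exact abs_lt.mp (lt_min hm hn)
  have hceil : ∀ t : ℝ, |t| < (⌈|t|⌉₊ : ℝ) + 1 := fun t =>
    (Nat.le_ceil _).trans_lt (lt_add_one _)
  refine ⟨fun t => α ⌈|t|⌉₊ t, by simp [hα0], fun t => ?_⟩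
  refine (hα ⌈|t|⌉₊ t (abs_lt.mp (hceil t))).congr_of_eventuallyEq ?_
  filter_upwards [Ioo_mem_nhds (abs_lt.mp (hceil t)).1 (abs_lt.mp (hceil t)).2] with s hs
  exact agree _ _ s (hceil s) (abs_lt.mpr hs)

/-- **Barbalat's lemma**: if a function converges and its derivative is uniformly continuous, then
the derivative tends to zero. -/
theorem tendsto_deriv_zero_of_uniformContinuous {F f : ℝ → ℝ} {l : ℝ}
    (hF : ∀ t, HasDerivAt F (f t) t) (hf : UniformContinuous f) (hl : Tendsto F atTop (𝓝 l)) :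
    Tendsto f atTop (𝓝 0) := by
  rw [Metric.tendsto_atTop]
  intro ε hε
  obtain ⟨δ, hδ, hfδ⟩ := Metric.uniformContinuous_iff.mp hf (ε / 2) (by positivity)
  obtain ⟨N, hN⟩ := Metric.tendsto_atTop.mp hl (ε * δ / 16) (by positivity)
  refine ⟨N, fun t ht => ?_⟩
  obtain ⟨ξ, hξ, hξe⟩ := exists_hasDerivAt_eq_slope F f (a := t) (b := t + δ / 2) (by linarith)
    (HasDerivAt.continuousOn fun x _ => hF x) fun x _ => hF x
  have h1 := hN t ht
  have h2 := hN (t + δ / 2) (by linarith)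
  have h3 : dist t ξ < δ := by
    rw [Real.dist_eq, abs_lt]; constructor <;> linarith [hξ.1, hξ.2]
  have h4 := hfδ h3
  rw [Real.dist_eq, abs_lt] at h1 h2 h4
  have h5 : f ξ * (δ / 2) = F (t + δ / 2) - F t := by
    rw [hξe, add_sub_cancel_left]; field_simp
  have h6 : f ξ < ε / 2 := by nlinarith
  have h7 : -(ε / 2) < f ξ := by nlinarith
  rw [Real.dist_eq, sub_zero, abs_lt]
  constructor <;> linarith

theorem exists_tendsto_atTop_of_antitoneOn_Ici {f : ℝ → ℝ} {a b : ℝ} (hf : AntitoneOn f (Ici a))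
    (hb : ∀ t ∈ Ici a, b ≤ f t) : ∃ l, Tendsto f atTop (𝓝 l) := by
  have hanti : Antitone fun t => f (max a t) := fun x y hxy =>
    hf (mem_Ici.mpr (le_max_left a x)) (mem_Ici.mpr (le_max_left a y)) (max_le_max le_rfl hxy)
  refine ⟨_, (tendsto_atTop_ciInf hanti ⟨b, ?_⟩).congr' ?_⟩
  · rintro _ ⟨t, rfl⟩
    exact hb _ (mem_Ici.mpr (le_max_left a t))
  · filter_upwards [eventually_ge_atTop a] with t ht
    rw [max_eq_right ht]

theorem lipschitzWith_of_forall_hasDerivAt {E : Type*} [NormedAddCommGroup E] [NormedSpace ℝ E]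
    {F f : ℝ → E} {C : ℝ≥0} (hF : ∀ t, HasDerivAt F (f t) t) (hf : ∀ t, ‖f t‖ ≤ C) :
    LipschitzWith C F :=
  lipschitzWith_of_nnnorm_deriv_le (fun t => (hF t).differentiableAt) fun t => by
    rw [(hF t).deriv]; exact hf t

/-- A function vanishing at `τ` with negative derivative there becomes negative right after `τ`,
while a continuous function positive at `τ` is still positive. -/
theorem exists_gt_neg_of_hasDerivAt {f h : ℝ → ℝ} {f' τ : ℝ} (hf : HasDerivAt f f' τ)
    (hτ : f τ = 0) (hf' : f' < 0) (hc : ContinuousAt h τ) (hh : 0 < h τ) :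
    ∃ t > τ, f t < 0 ∧ ∀ r ∈ Icc τ t, 0 < h r := by
  have hs : ∀ᶠ t in 𝓝[>] τ, slope f τ t < 0 :=
    (hasDerivAt_iff_tendsto_slope.mp hf |>.mono_left
      (nhdsWithin_mono _ fun x hx => ne_of_gt hx)).eventually_lt_const hf'
  obtain ⟨δ, hδ, hhδ⟩ := Metric.eventually_nhds_iff.mp (hc.eventually (lt_mem_nhds hh))
  have hlt : ∀ᶠ t in 𝓝[>] τ, t < τ + δ :=
    (eventually_lt_nhds (by linarith : τ < τ + δ)).filter_mono nhdsWithin_le_nhds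
  obtain ⟨t, ht, htδ, htτ⟩ := (hs.and (hlt.and self_mem_nhdsWithin)).exists
  have htτ : τ < t := htτ
  refine ⟨t, htτ, ?_, fun r hr => hhδ ?_⟩
  · rw [slope_def_field, hτ, sub_zero] at ht
    exact (div_neg_iff.mp ht).elim (fun h => absurd h.2 (by linarith)) fun h => h.1
  · rw [Real.dist_eq, abs_lt]; constructor <;> linarith [hr.1, hr.2]

/-- The retraction of `ℝ` onto `[-M, M]`. -/
def clamp (M x : ℝ) : ℝ := max (-M) (min M x)

theorem lipschitzWith_clamp (M : ℝ) : LipschitzWith 1 (clamp M) :=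
  (LipschitzWith.id.const_min M).const_max (-M)

theorem abs_clamp_le {M : ℝ} (hM : 0 ≤ M) (x : ℝ) : |clamp M x| ≤ M := by
  unfold clamp; grind

theorem clamp_of_abs_le {M x : ℝ} (h : |x| ≤ M) : clamp M x = x := by
  unfold clamp; grind

theorem clamp_mono (M : ℝ) : Monotone (clamp M) := by
  intro x y h; unfold clamp; grind

/-- Shooting: among the solutions of `B' = -c(w)`, `w' = s₃ c(w) - g(B)` starting on the segment
`{a} × [0, V]`, one stays in the open first quadrant forever. -/
theorem exists_solution_pos {c g : ℝ → ℝ} {s₃ a V C G : ℝ} {Kc Kg : ℝ≥0}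
    (hcL : LipschitzWith Kc c) (hgL : LipschitzWith Kg g) (hcb : ∀ x, |c x| ≤ C)
    (hgb : ∀ x, |g x| ≤ G) (hc0 : c 0 = 0) (hcpos : ∀ x, 0 < x → 0 < c x) (hcm : Monotone c)
    (hg0 : g 0 = 0) (hgpos : ∀ x ∈ Ioc 0 a, 0 < g x) (ha : 0 < a) (hV : 0 < V) (h3 : 0 < s₃)
    (hGV : G < s₃ * c V) :
    ∃ B w : ℝ → ℝ, B 0 = a ∧ (∀ t, HasDerivAt B (-c (w t)) t) ∧
      (∀ t, HasDerivAt w (s₃ * c (w t) - g (B t)) t) ∧ ∀ t, 0 ≤ t → 0 < B t ∧ 0 < w t := by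
  let f : ℝ × ℝ → ℝ × ℝ := fun p => (-c p.2, s₃ * c p.2 - g p.1)
  obtain ⟨K, hK⟩ : ∃ K, LipschitzWith K f :=
    ⟨_, (hcL.comp LipschitzWith.prod_snd).neg.prodMk
      (((lipschitzWith_smul s₃).comp (hcL.comp LipschitzWith.prod_snd)).sub
        (hgL.comp LipschitzWith.prod_fst))⟩
  have hC : 0 ≤ C := (abs_nonneg _).trans (hcb 0)
  have hG : 0 ≤ G := (abs_nonneg _).trans (hgb 0)
  have hL : ∀ p, ‖f p‖ ≤ (⟨C + (s₃ * C + G), by positivity⟩ : ℝ≥0) := by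
    intro p
    have h1 := hcb p.2
    have h2 := hgb p.1
    have h4 : |s₃ * c p.2| ≤ s₃ * C := by
      rw [abs_mul, abs_of_pos h3]; gcongr
    have h5 : 0 ≤ s₃ * C := by positivity
    refine max_le ?_ ?_
    · change |-c p.2| ≤ C + (s₃ * C + G)
      rw [abs_neg]; linarith
    · change |s₃ * c p.2 - g p.1| ≤ C + (s₃ * C + G)
      exact (abs_sub _ _).trans (by linarith)
  choose α hα0 hα using fun s : ℝ =>
    exists_global_solution_of_lipschitzWith_of_bounded hK hL (a, s)
  have hB : ∀ s t, HasDerivAt (fun t => (α s t).1) (-c (α s t).2) t := fun s t => (hα s t).fst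
  have hw : ∀ s t, HasDerivAt (fun t => (α s t).2) (s₃ * c (α s t).2 - g (α s t).1) t :=
    fun s t => (hα s t).snd
  have hBc : ∀ s, Continuous fun t => (α s t).1 := fun s =>
    continuous_iff_continuousAt.mpr fun t => (hB s t).continuousAt
  have hwc : ∀ s, Continuous fun t => (α s t).2 := fun s =>
    continuous_iff_continuousAt.mpr fun t => (hw s t).continuousAt
  have hdep : ∀ s T ε : ℝ, 0 < ε →
      ∀ᶠ s' in 𝓝 s, ∀ t ∈ Icc 0 T, dist (α s' t) (α s t) < ε := by
    intro s T ε hε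
    have hlim : Tendsto (fun s' => dist s' s * Real.exp (K * T)) (𝓝 s) (𝓝 0) := by
      have : Continuous fun s' => dist s' s * Real.exp (K * T) := by fun_prop
      simpa using this.tendsto s
    filter_upwards [hlim.eventually_lt_const hε] with s' hs' t ht
    refine lt_of_le_of_lt ?_ hs'
    have := dist_le_of_trajectories_ODE (v := fun _ => f) (a := 0) (b := T) (fun _ => hK)
      (HasDerivAt.continuousOn fun t _ => hα s' t) (fun t _ => (hα s' t).hasDerivWithinAt)
      (HasDerivAt.continuousOn fun t _ => hα s t) (fun t _ => (hα s t).hasDerivWithinAt)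
      (δ := dist s' s) (by simp [hα0, Prod.dist_eq]) t ht
    refine this.trans ?_
    have := ht.2
    gcongr
    simpa using this
  let U : Set ℝ := {s | ∃ t ≥ 0, (α s t).1 < 0 ∧ ∀ r ∈ Icc 0 t, 0 < (α s r).2}
  let W : Set ℝ := {s | ∃ t ≥ 0, (α s t).2 < 0 ∧ ∀ r ∈ Icc 0 t, 0 < (α s r).1}
  have hopen : ∀ p q : ℝ × ℝ → ℝ, LipschitzWith 1 p → LipschitzWith 1 q →
      IsOpen {s | ∃ t ≥ 0, p (α s t) < 0 ∧ ∀ r ∈ Icc 0 t, 0 < q (α s r)} := by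
    intro p q hp hq
    rw [isOpen_iff_mem_nhds]
    rintro s ⟨t, ht, hpt, hqt⟩
    have hαc : Continuous (α s) := continuous_iff_continuousAt.mpr fun t => (hα s t).continuousAt
    obtain ⟨r₀, hr₀, hmin⟩ := (isCompact_Icc (a := (0 : ℝ)) (b := t)).exists_isMinOn
      (nonempty_Icc.mpr ht) (hq.continuous.comp hαc).continuousOn
    filter_upwards [hdep s t (min (-p (α s t)) (q (α s r₀)))
      (lt_min (by linarith) (hqt r₀ hr₀))] with s' hs'
    refine ⟨t, ht, ?_, fun r hr => ?_⟩
    · have h1 := hp.dist_le_mul (α s' t) (α s t)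
      have h2 := (hs' t ⟨ht, le_rfl⟩).trans_le (min_le_left _ _)
      rw [NNReal.coe_one, one_mul, Real.dist_eq] at h1
      linarith [(abs_le.mp h1).2]
    · have h1 := hq.dist_le_mul (α s' r) (α s r)
      have h2 := (hs' r hr).trans_le (min_le_right _ _)
      have h4 : q (α s r₀) ≤ q (α s r) := hmin hr
      rw [NNReal.coe_one, one_mul, Real.dist_eq] at h1
      linarith [(abs_le.mp h1).1]
  have hU : IsOpen U := hopen _ _ LipschitzWith.prod_fst LipschitzWith.prod_snd
  have hW : IsOpen W := hopen _ _ LipschitzWith.prod_snd LipschitzWith.prod_fst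
  have hdisj : Disjoint U W := by
    rw [Set.disjoint_left]
    rintro s ⟨t, ht, ht1, ht2⟩ ⟨r, hr, hr1, hr2⟩
    rcases le_total t r with h | h
    · exact lt_asymm ht1 (hr2 t ⟨ht, h⟩)
    · exact lt_asymm hr1 (ht2 r ⟨hr, h⟩)
  have h0W : 0 ∈ W := by
    have hd := hw 0 0
    simp only [hα0, hc0, mul_zero, zero_sub] at hd
    obtain ⟨t, ht, h1, h2⟩ := exists_gt_neg_of_hasDerivAt hd (by simp [hα0])
      (neg_lt_zero.mpr (hgpos a ⟨ha, le_rfl⟩)) (hBc 0).continuousAt (by simpa [hα0] using ha)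
    exact ⟨t, ht.le, h1, h2⟩
  have hVU : V ∈ U := by
    have hVw : ∀ t, 0 ≤ t → V ≤ (α V t).2 := by
      intro t ht
      have := image_le_of_deriv_right_lt_deriv_boundary (f := fun t => -(α V t).2)
        (B := fun _ => -V) (B' := fun _ => 0) (a := 0) (b := t) (hwc V).neg.continuousOn
        (fun x _ => (hw V x).neg.hasDerivWithinAt) (by simp [hα0])
        (fun x => hasDerivAt_const x _) ?_ (right_mem_Icc.mpr ht)
      · linarith
      · intro x _ hx
        have hx : (α V x).2 = V := neg_injective hx
        rw [hx]
        linarith [(abs_le.mp (hgb (α V x).1)).2]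
    have hcV : 0 < c V := hcpos V hV
    have hdec : ∀ t, 0 ≤ t → (α V t).1 ≤ a - c V * t := by
      intro t ht
      refine image_le_of_deriv_right_le_deriv_boundary (f := fun t => (α V t).1)
        (B := fun t => a - c V * t) (B' := fun _ => -c V) (a := 0) (b := t) (hBc V).continuousOn
        (fun x _ => (hB V x).hasDerivWithinAt) (by simp [hα0]) (by fun_prop)
        (fun x _ => ?_) (fun x hx => neg_le_neg (hcm (hVw x hx.1))) (right_mem_Icc.mpr ht)
      simpa using (((hasDerivAt_id x).const_mul (c V)).const_sub a).hasDerivWithinAt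
    refine ⟨(a + 1) / c V, by positivity, ?_, fun r hr => hV.trans_le (hVw r hr.1)⟩
    have := hdec ((a + 1) / c V) (by positivity)
    rw [mul_div_cancel₀ _ hcV.ne'] at this
    linarith
  obtain ⟨s, hs, hsU, hsW⟩ : ∃ s ∈ Icc 0 V, s ∉ U ∧ s ∉ W := by
    by_contra! hcon
    have hsub : Icc 0 V ⊆ U ∪ W := fun s hs => or_iff_not_imp_left.mpr (hcon s hs)
    rcases (isPreconnected_Icc (a := (0 : ℝ)) (b := V)).subset_or_subset hU hW hdisj hsub with h | h
    · exact Set.disjoint_left.mp hdisj (h (left_mem_Icc.mpr hV.le)) h0W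
    · exact Set.disjoint_left.mp hdisj hVU (h (right_mem_Icc.mpr hV.le))
  refine ⟨fun t => (α s t).1, fun t => (α s t).2, by simp [hα0], hB s, hw s, ?_⟩
  by_contra! hcon
  let Z : Set ℝ := Ici 0 ∩ {t | (α s t).1 ≤ 0 ∨ (α s t).2 ≤ 0}
  have hZc : IsClosed Z := isClosed_Ici.inter
    ((isClosed_le (hBc s) continuous_const).union (isClosed_le (hwc s) continuous_const))
  have hZne : Z.Nonempty := by
    obtain ⟨t, ht, h⟩ := hcon
    exact ⟨t, ht, or_iff_not_imp_left.mpr fun hn => h (not_le.mp hn)⟩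
  have hZb : BddBelow Z := ⟨0, fun t ht => ht.1⟩
  obtain ⟨hτ0, hτ⟩ := hZc.csInf_mem hZne hZb
  set τ := sInf Z
  have hτ0 : 0 ≤ τ := hτ0
  have hbefore : ∀ r, 0 ≤ r → r < τ → 0 < (α s r).1 ∧ 0 < (α s r).2 := by
    intro r hr hrτ
    by_contra! hn
    refine absurd (csInf_le hZb (show r ∈ Z from ⟨hr, ?_⟩)) (not_le.mpr hrτ)
    exact or_iff_not_imp_left.mpr fun h => hn (not_le.mp h)
  have hat : 0 ≤ (α s τ).1 ∧ 0 ≤ (α s τ).2 := by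
    rcases hτ0.eq_or_lt with h | h
    · rw [← h, hα0]; exact ⟨ha.le, hs.1⟩
    · have hev : ∀ᶠ r in 𝓝[<] τ, 0 < (α s r).1 ∧ 0 < (α s r).2 := by
        filter_upwards [Ioo_mem_nhdsLT h] with r hr using hbefore r hr.1.le hr.2
      exact ⟨ge_of_tendsto ((hBc s).continuousWithinAt) (hev.mono fun _ h => h.1.le),
        ge_of_tendsto ((hwc s).continuousWithinAt) (hev.mono fun _ h => h.2.le)⟩
  have hBa : (α s τ).1 ≤ a := by
    refine image_le_of_deriv_right_le_deriv_boundary (f := fun t => (α s t).1)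
        (B := fun t => a) (B' := fun _ => 0) (a := 0) (b := τ) (hBc s).continuousOn
        (fun x _ => (hB s x).hasDerivWithinAt) (by simp [hα0]) (by fun_prop)
        (fun x _ => hasDerivWithinAt_const ..) (fun x hx => ?_) (right_mem_Icc.mpr hτ0)
    exact neg_nonpos.mpr (hcpos _ (hbefore x hx.1 hx.2).2).le
  rcases hat.1.eq_or_lt with h1 | h1 <;> rcases hat.2.eq_or_lt with h2 | h2
  · have heq : α s = fun _ => 0 := by
      refine ODE_solution_unique_univ (v := fun _ => f) (s := fun _ => univ) (t₀ := τ)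
        (fun _ => hK.lipschitzOnWith) (fun t => ⟨hα s t, trivial⟩)
        (fun t => ⟨?_, trivial⟩) (Prod.ext h1.symm h2.symm)
      convert! hasDerivAt_const t (0 : ℝ × ℝ)
      simp [f, hc0, hg0]
    have := hα0 s
    rw [heq] at this
    exact ha.ne (congrArg Prod.fst this)
  · obtain ⟨t, ht, h5, h6⟩ := exists_gt_neg_of_hasDerivAt (hB s τ) h1.symm
      (neg_lt_zero.mpr (hcpos _ h2)) (hwc s).continuousAt h2
    refine hsU ⟨t, hτ0.trans ht.le, h5, fun r hr => ?_⟩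
    rcases lt_or_ge r τ with h | h
    · exact (hbefore r hr.1 h).2
    · exact h6 r ⟨h, hr.2⟩
  · have hd := hw s τ
    rw [← h2, hc0, mul_zero, zero_sub] at hd
    obtain ⟨t, ht, h5, h6⟩ := exists_gt_neg_of_hasDerivAt hd h2.symm
      (neg_lt_zero.mpr (hgpos _ ⟨h1, hBa⟩)) (hBc s).continuousAt h1
    refine hsW ⟨t, hτ0.trans ht.le, h5, fun r hr => ?_⟩
    rcases lt_or_ge r τ with h | h
    · exact (hbefore r hr.1 h).1
    · exact h6 r ⟨h, hr.2⟩
  · rcases hτ with h | h <;> linarith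

theorem hasDerivAt_integral_zero {f : ℝ → ℝ} (hf : Continuous f) (x : ℝ) :
    HasDerivAt (fun x => ∫ y in (0 : ℝ)..x, f y) (f x) x :=
  (hf.integral_hasStrictDerivAt 0 x).hasDerivAt

/-- A primitive of a function pointing away from `[-m, m]` is bounded below outside `[-m, m]` by
its values at the endpoints. -/
theorem le_integral_of_le_abs {f : ℝ → ℝ} {m L x : ℝ} (hf : Continuous f)
    (hpos : ∀ y, m ≤ y → 0 ≤ f y) (hneg : ∀ y, y ≤ -m → f y ≤ 0)
    (hm : L ≤ ∫ y in (0 : ℝ)..m, f y) (hm' : L ≤ ∫ y in (0 : ℝ)..-m, f y) (hx : m ≤ |x|) :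
    L ≤ ∫ y in (0 : ℝ)..x, f y := by
  rcases le_abs.mp hx with h | h
  · rw [← intervalIntegral.integral_add_adjacent_intervals (hf.intervalIntegrable 0 m)
      (hf.intervalIntegrable m x)]
    have := intervalIntegral.integral_nonneg (μ := MeasureTheory.volume) h
      fun y hy => hpos y hy.1
    linarith
  · have hxm : x ≤ -m := by linarith
    rw [← intervalIntegral.integral_add_adjacent_intervals (hf.intervalIntegrable 0 (-m))
      (hf.intervalIntegrable (-m) x), intervalIntegral.integral_symm x (-m),
      ← intervalIntegral.integral_neg]
    have := intervalIntegral.integral_nonneg (μ := MeasureTheory.volume) hxm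
      fun y hy => neg_nonneg.mpr (hneg y hy.2)
    linarith

theorem abs_le_of_mem_uIcc_zero {x y : ℝ} (h : y ∈ uIcc 0 x) : |y| ≤ |x| := by
  simpa using abs_sub_left_of_mem_uIcc h

theorem integral_clamp {M x : ℝ} (hx : |x| ≤ M) : ∫ y in (0 : ℝ)..x, clamp M y = x ^ 2 / 2 := by
  rw [intervalIntegral.integral_congr (g := fun y => y) fun y hy =>
    clamp_of_abs_le ((abs_le_of_mem_uIcc_zero hy).trans hx)]
  simp

theorem clamp_of_le {M x : ℝ} (hM : 0 ≤ M) (hx : M ≤ x) : clamp M x = M := by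
  unfold clamp; grind

theorem clamp_of_le_neg {M x : ℝ} (hM : 0 ≤ M) (hx : x ≤ -M) : clamp M x = -M := by
  unfold clamp; grind

theorem clamp_pos {M x : ℝ} (hM : 0 < M) (hx : 0 < x) : 0 < clamp M x := by
  unfold clamp; grind

/-- The cubic `s₁ x - s₂ x³`, frozen outside `[-m, m]`. -/
def clampedCubic (s₁ s₂ m x : ℝ) : ℝ := s₁ * clamp m x - s₂ * clamp m x ^ 3

theorem clampedCubic_of_abs_le {s₁ s₂ m x : ℝ} (h : |x| ≤ m) :
    clampedCubic s₁ s₂ m x = s₁ * x - s₂ * x ^ 3 := by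
  rw [clampedCubic, clamp_of_abs_le h]

theorem abs_clampedCubic_le {s₁ s₂ m : ℝ} (h1 : 0 ≤ s₁) (h2 : 0 ≤ s₂) (hm : 0 ≤ m) (x : ℝ) :
    |clampedCubic s₁ s₂ m x| ≤ s₁ * m + s₂ * m ^ 3 := by
  have h := abs_clamp_le hm x
  refine (abs_sub _ _).trans ?_
  rw [abs_mul, abs_mul, abs_pow, abs_of_nonneg h1, abs_of_nonneg h2]
  gcongr

theorem exists_lipschitzWith_clampedCubic {s₁ s₂ m : ℝ} (h1 : 0 ≤ s₁) (h2 : 0 ≤ s₂) (hm : 0 ≤ m) :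
    ∃ K : ℝ≥0, LipschitzWith K (clampedCubic s₁ s₂ m) := by
  refine ⟨⟨s₁ + s₂ * (3 * m ^ 2), by positivity⟩, LipschitzWith.of_dist_le_mul fun x y => ?_⟩
  have hx := abs_le.mp (abs_clamp_le hm x)
  have hy := abs_le.mp (abs_clamp_le hm y)
  have hxy := (lipschitzWith_clamp m).dist_le_mul x y
  rw [NNReal.coe_one, one_mul, Real.dist_eq] at hxy
  have heq : clampedCubic s₁ s₂ m x - clampedCubic s₁ s₂ m y =
      (s₁ - s₂ * (clamp m x ^ 2 + clamp m x * clamp m y + clamp m y ^ 2)) *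
        (clamp m x - clamp m y) := by
    simp only [clampedCubic]; ring
  rw [Real.dist_eq, heq, abs_mul]
  refine mul_le_mul ?_ hxy (abs_nonneg _) (NNReal.coe_nonneg _)
  change _ ≤ s₁ + s₂ * (3 * m ^ 2)
  set X := clamp m x
  set Y := clamp m y
  have hq : X ^ 2 + X * Y + Y ^ 2 ≤ 3 * m ^ 2 := by nlinarith
  have hq0 : 0 ≤ X ^ 2 + X * Y + Y ^ 2 := by nlinarith [sq_nonneg (X + Y)]
  have := mul_le_mul_of_nonneg_left hq h2
  have := mul_nonneg h2 hq0
  rw [abs_le]; constructor <;> linarith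

theorem integral_clampedCubic {s₁ s₂ m x : ℝ} (hx : |x| ≤ m) :
    ∫ y in (0 : ℝ)..x, clampedCubic s₁ s₂ m y = s₁ * x ^ 2 / 2 - s₂ * x ^ 4 / 4 := by
  rw [intervalIntegral.integral_congr (g := fun y => s₁ * y - s₂ * y ^ 3) fun y hy =>
    clampedCubic_of_abs_le ((abs_le_of_mem_uIcc_zero hy).trans hx)]
  rw [intervalIntegral.integral_sub (Continuous.intervalIntegrable (by fun_prop) _ _)
    (Continuous.intervalIntegrable (by fun_prop) _ _),
    intervalIntegral.integral_const_mul, intervalIntegral.integral_const_mul, integral_id,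
    integral_pow]
  norm_num
  ring

/-- The one-dimensional unstable manifold of the origin, with the orbit on it staying bounded. -/
theorem exists_unstable_orbit {s₁ s₂ s₃ q : ℝ} (h2 : 0 < s₂) (h3 : 0 < s₃) (hq : 0 < q)
    (hs : s₁ = s₂ * q ^ 2) :
    ∃ (A v : ℝ → ℝ) (m M : ℝ), (∀ t, HasDerivAt A (v t) t) ∧
      (∀ t, HasDerivAt v (s₁ * A t - s₂ * A t ^ 3 - s₃ * v t) t) ∧
      (∀ t, |A t| ≤ m) ∧ (∀ t, |v t| ≤ M) ∧ (∀ t ≤ 0, 0 < A t ∧ 0 < v t) ∧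
      Tendsto A atBot (𝓝 0) ∧ Tendsto v atBot (𝓝 0) := by
  have h1 : 0 < s₁ := by rw [hs]; positivity
  let m := 2 * q
  let a := q / 2
  let G := s₁ * m + s₂ * m ^ 3
  let V := (G + 1) / s₃
  let M := V + s₁ + q ^ 2
  have hm : 0 < m := by positivity
  have ha : 0 < a := by positivity
  have hG : 0 < G := by positivity
  have hV : 0 < V := by positivity
  have hM : 0 < M := by positivity
  have hVM : V ≤ M := by simp only [M]; nlinarith [sq_nonneg q]
  have hMsq : 4 * s₁ * q ^ 2 < M ^ 2 := by
    have : (s₁ + q ^ 2) ^ 2 < M ^ 2 := by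
      have h0 : 0 < s₁ + q ^ 2 := by positivity
      have h4 : s₁ + q ^ 2 < M := by simp only [M]; linarith
      gcongr
    nlinarith [sq_nonneg (s₁ - q ^ 2)]
  have ham : a ≤ m := by simp only [a, m]; linarith
  let c := clamp M
  let g := clampedCubic s₁ s₂ m
  have hcL : LipschitzWith 1 c := lipschitzWith_clamp M
  obtain ⟨Kg, hgL⟩ : ∃ K, LipschitzWith K g :=
    exists_lipschitzWith_clampedCubic h1.le h2.le hm.le
  have hcb : ∀ x, |c x| ≤ M := abs_clamp_le hM.le
  have hgb : ∀ x, |g x| ≤ G := abs_clampedCubic_le h1.le h2.le hm.le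
  have hc0 : c 0 = 0 := clamp_of_abs_le (by simpa using hM.le)
  have hg0 : g 0 = 0 := by
    have : g 0 = _ := clampedCubic_of_abs_le (by simpa using hm.le)
    simpa using this
  have hcpos : ∀ x, 0 < x → 0 < c x := fun x => clamp_pos hM
  have hglow : ∀ x, 0 < x → x ≤ a → 3 / 4 * s₁ * x ≤ g x := by
    intro x hx hxa
    have hxm : |x| ≤ m := by rw [abs_of_pos hx]; exact hxa.trans ham
    have : g x = _ := clampedCubic_of_abs_le hxm
    have h4 : x ^ 2 ≤ a ^ 2 := by gcongr
    have h5 : s₂ * x * x ^ 2 ≤ s₂ * x * a ^ 2 := by gcongr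
    rw [this, hs]
    simp only [a] at h5
    linarith
  obtain ⟨B, w, hB0, hB, hw, hpos⟩ := exists_solution_pos (c := c) (g := g) (V := V) hcL hgL hcb
    hgb hc0 hcpos (clamp_mono M) hg0
    (fun x hx => lt_of_lt_of_le (by have := hx.1; positivity) (hglow x hx.1 hx.2)) ha hV h3
    (by
      have : c V = V := clamp_of_abs_le (by rwa [abs_of_pos hV])
      rw [this, mul_div_cancel₀ _ h3.ne']
      linarith)
  have hBL : LipschitzWith ⟨M, hM.le⟩ B := lipschitzWith_of_forall_hasDerivAt hB fun t => by
    rw [norm_neg]; exact hcb _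
  have hwL : LipschitzWith ⟨s₃ * M + G, by positivity⟩ w :=
    lipschitzWith_of_forall_hasDerivAt hw fun t => by
      refine (abs_sub _ _).trans ?_
      rw [abs_mul, abs_of_pos h3]
      have := hcb (w t)
      have := hgb (B t)
      change _ ≤ s₃ * M + G
      gcongr
  have hBanti : AntitoneOn B (Ici 0) := by
    refine antitoneOn_of_deriv_nonpos (convex_Ici 0) hBL.continuous.continuousOn
      (fun t _ => (hB t).differentiableAt.differentiableWithinAt) fun t ht => ?_
    rw [interior_Ici] at ht
    rw [(hB t).deriv]
    exact neg_nonpos.mpr (hcpos _ (hpos t (le_of_lt ht)).2).le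
  have hBa : ∀ t, 0 ≤ t → B t ≤ a := fun t ht => hB0 ▸ hBanti self_mem_Ici ht ht
  obtain ⟨l, hl⟩ := exists_tendsto_atTop_of_antitoneOn_Ici hBanti (b := 0)
    fun t ht => (hpos t ht).1.le
  have hcw : Tendsto (fun t => c (w t)) atTop (𝓝 0) := by
    have := tendsto_deriv_zero_of_uniformContinuous hB
      (hcL.uniformContinuous.comp hwL.uniformContinuous).neg hl
    simpa using this.neg
  have hw0 : Tendsto w atTop (𝓝 0) := by
    refine hcw.congr' ?_
    filter_upwards [hcw.eventually_lt_const hM, eventually_ge_atTop 0] with t ht ht0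
    have hwt := (hpos t ht0).2
    refine clamp_of_abs_le ?_
    rw [abs_of_pos hwt]
    by_contra! hlt
    exact ht.ne (clamp_of_le hM.le hlt.le)
  have hgB : Tendsto (fun t => g (B t)) atTop (𝓝 0) := by
    have hUC : UniformContinuous fun t => s₃ * c (w t) - g (B t) :=
      ((hcL.uniformContinuous.comp hwL.uniformContinuous).const_mul' s₃).sub
        (hgL.uniformContinuous.comp hBL.uniformContinuous)
    have := tendsto_deriv_zero_of_uniformContinuous hw hUC hw0
    simpa using (hcw.const_mul s₃).sub this
  have hBlim : Tendsto B atTop (𝓝 0) := by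
    refine tendsto_of_tendsto_of_tendsto_of_le_of_le' tendsto_const_nhds
      (by simpa using hgB.div_const (3 / 4 * s₁)) ?_ ?_
    · filter_upwards [eventually_ge_atTop 0] with t ht using (hpos t ht).1.le
    · filter_upwards [eventually_ge_atTop 0] with t ht
      rw [le_div_iff₀' (by positivity)]
      exact hglow _ (hpos t ht).1 (hBa t ht)
  have hA : ∀ t, HasDerivAt (fun t => B (-t)) (c (w (-t))) t := fun t => by
    simpa [Function.comp_def] using (hB (-t)).scomp t (hasDerivAt_neg t)
  have hv : ∀ t, HasDerivAt (fun t => w (-t)) (g (B (-t)) - s₃ * c (w (-t))) t := fun t => by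
    simpa [Function.comp_def] using (hw (-t)).scomp t (hasDerivAt_neg t)
  let Φ : ℝ → ℝ := fun x => ∫ y in (0 : ℝ)..x, c y
  let Γ : ℝ → ℝ := fun x => ∫ y in (0 : ℝ)..x, g y
  have hΦ : ∀ x, HasDerivAt Φ (c x) x := hasDerivAt_integral_zero hcL.continuous
  have hΓ : ∀ x, HasDerivAt Γ (g x) x := hasDerivAt_integral_zero hgL.continuous
  have hH : ∀ t, HasDerivAt (fun t => Φ (w (-t)) - Γ (B (-t))) (-(s₃ * c (w (-t)) ^ 2)) t := by
    intro t
    convert! ((hΦ _).comp t (hv t)).sub ((hΓ _).comp t (hA t)) using 1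
    ring
  have hHanti : Antitone fun t => Φ (w (-t)) - Γ (B (-t)) :=
    antitone_of_deriv_nonpos (fun t => (hH t).differentiableAt) fun t => by
      rw [(hH t).deriv, neg_nonpos]; positivity
  have hAbot : Tendsto (fun t => B (-t)) atBot (𝓝 0) := hBlim.comp tendsto_neg_atBot_atTop
  have hvbot : Tendsto (fun t => w (-t)) atBot (𝓝 0) := hw0.comp tendsto_neg_atBot_atTop
  have hHbot : Tendsto (fun t => Φ (w (-t)) - Γ (B (-t))) atBot (𝓝 0) := by
    have h4 := (hΦ 0).continuousAt.tendsto.comp hvbot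
    have h5 := (hΓ 0).continuousAt.tendsto.comp hAbot
    simpa [Φ, Γ] using h4.sub h5
  have hH0 : ∀ t, Φ (w (-t)) ≤ Γ (B (-t)) := fun t =>
    sub_nonpos.mp (hHanti.ge_of_tendsto hHbot t)
  have hΦout : ∀ x, M ≤ |x| → M ^ 2 / 2 ≤ Φ x := by
    intro x hx
    refine le_integral_of_le_abs hcL.continuous
      (fun y hy => by simpa only [c, clamp_of_le hM.le hy] using hM.le)
      (fun y hy => by simpa only [c, clamp_of_le_neg hM.le hy] using neg_nonpos.mpr hM.le)
      (integral_clamp (abs_of_pos hM).le).ge ?_ hx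
    have := integral_clamp (M := M) (x := -M) (by rw [abs_neg, abs_of_pos hM])
    rw [neg_sq] at this
    exact this.ge
  have hΓout : ∀ x, m ≤ |x| → Γ x < 0 := by
    intro x hx
    have hval : ∫ y in (0 : ℝ)..m, g y = -(2 * s₂ * q ^ 4) := by
      rw [integral_clampedCubic (abs_of_pos hm).le, hs]; simp only [m]; ring
    have hval' : ∫ y in (0 : ℝ)..-m, g y = -(2 * s₂ * q ^ 4) := by
      rw [integral_clampedCubic (by rw [abs_neg, abs_of_pos hm]), hs]; simp only [m]; ring
    have := le_integral_of_le_abs (f := fun y => -g y) (m := m) (L := 2 * s₂ * q ^ 4) (x := x)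
      hgL.continuous.neg ?_ ?_ ?_ ?_ hx
    · rw [intervalIntegral.integral_neg] at this
      have h4 : 0 < 2 * s₂ * q ^ 4 := by positivity
      change ∫ y in (0 : ℝ)..x, g y < 0
      linarith
    · intro y hy
      simp only [g, clampedCubic, clamp_of_le hm.le hy, hs, m]
      have : 0 < s₂ * q ^ 3 := by positivity
      linarith
    · intro y hy
      simp only [g, clampedCubic, clamp_of_le_neg hm.le hy, hs, m]
      have : 0 < s₂ * q ^ 3 := by positivity
      linarith
    · rw [intervalIntegral.integral_neg, hval, neg_neg]
    · rw [intervalIntegral.integral_neg, hval', neg_neg]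
  have hΦnonneg : ∀ x, 0 ≤ Φ x := by
    intro x
    rcases le_total M |x| with h | h
    · exact le_trans (by positivity) (hΦout x h)
    · have : Φ x = _ := integral_clamp h
      rw [this]; positivity
  have hAm : ∀ t, |B (-t)| ≤ m := by
    intro t
    by_contra! h
    linarith [hΓout _ h.le, hH0 t, hΦnonneg (w (-t))]
  have hvM : ∀ t, |w (-t)| ≤ M := by
    intro t
    by_contra! h
    have h4 := hΦout _ h.le
    have h5 : Γ (B (-t)) = _ := integral_clampedCubic (hAm t)
    have h6 : B (-t) ^ 2 ≤ m ^ 2 := sq_le_sq' (abs_le.mp (hAm t)).1 (abs_le.mp (hAm t)).2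
    have h7 : s₁ * B (-t) ^ 2 ≤ s₁ * m ^ 2 := by gcongr
    have h8 : 0 ≤ s₂ * B (-t) ^ 4 := by positivity
    have := hH0 t
    simp only [m] at h7
    linarith
  refine ⟨fun t => B (-t), fun t => w (-t), m, M, fun t => ?_, fun t => ?_, hAm, hvM,
    fun t ht => hpos _ (neg_nonneg.mpr ht), hAbot, hvbot⟩
  · have := hA t
    rwa [show c (w (-t)) = _ from clamp_of_abs_le (hvM t)] at this
  · have := hv t
    rwa [show g (B (-t)) = _ from clampedCubic_of_abs_le (hAm t),
      show c (w (-t)) = _ from clamp_of_abs_le (hvM t)] at this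

/-- A bounded orbit emanating from the origin into the first quadrant converges to the positive
equilibrium. -/
theorem tendsto_equilibrium {s₁ s₂ s₃ q m M : ℝ} {A v : ℝ → ℝ} (h2 : 0 < s₂) (h3 : 0 < s₃)
    (hq : 0 < q) (hs : s₁ = s₂ * q ^ 2) (hA : ∀ t, HasDerivAt A (v t) t)
    (hv : ∀ t, HasDerivAt v (s₁ * A t - s₂ * A t ^ 3 - s₃ * v t) t) (hAm : ∀ t, |A t| ≤ m)
    (hvM : ∀ t, |v t| ≤ M) (hpos : ∀ t ≤ 0, 0 < A t ∧ 0 < v t) (hA0 : Tendsto A atBot (𝓝 0))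
    (hv0 : Tendsto v atBot (𝓝 0)) : Tendsto A atTop (𝓝 q) ∧ Tendsto v atTop (𝓝 0) := by
  have h1 : 0 < s₁ := by rw [hs]; positivity
  have hm : 0 ≤ m := (abs_nonneg _).trans (hAm 0)
  have hM : 0 ≤ M := (abs_nonneg _).trans (hvM 0)
  have hAc : Continuous A := continuous_iff_continuousAt.mpr fun t => (hA t).continuousAt
  let E : ℝ → ℝ := fun t => v t ^ 2 / 2 - s₁ * A t ^ 2 / 2 + s₂ * A t ^ 4 / 4
  have hE : ∀ t, HasDerivAt E (-(s₃ * v t ^ 2)) t := by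
    intro t
    convert! ((((hv t).pow 2).div_const 2).sub ((((hA t).pow 2).const_mul s₁).div_const 2)).add
      ((((hA t).pow 4).const_mul s₂).div_const 4) using 1
    norm_num
    ring
  have hEanti : Antitone E :=
    antitone_of_deriv_nonpos (fun t => (hE t).differentiableAt) fun t => by
      rw [(hE t).deriv, neg_nonpos]; positivity
  have hEbot : Tendsto E atBot (𝓝 0) := by
    have := (((hv0.pow 2).div_const 2).sub (((hA0.pow 2).const_mul s₁).div_const 2)).add
      (((hA0.pow 4).const_mul s₂).div_const 4)
    simpa using this
  have hE0 : E 0 < 0 := by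
    have hstrict : StrictAntiOn E (Iic 0) := by
      refine strictAntiOn_of_deriv_neg (convex_Iic 0)
        (HasDerivAt.continuousOn fun t _ => hE t) fun t ht => ?_
      rw [interior_Iic] at ht
      have := (hpos t (le_of_lt ht)).2
      rw [(hE t).deriv, neg_lt_zero]
      positivity
    exact (hstrict (by simp : (-1 : ℝ) ∈ Iic 0) self_mem_Iic (by norm_num)).trans_le
      (hEanti.ge_of_tendsto hEbot _)
  obtain ⟨l, hl⟩ := exists_tendsto_atTop_of_antitoneOn_Ici (hEanti.antitoneOn (Ici 0))
    (b := -(s₁ * m ^ 2 / 2)) fun t _ => by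
      have h4 : A t ^ 2 ≤ m ^ 2 := sq_le_sq' (abs_le.mp (hAm t)).1 (abs_le.mp (hAm t)).2
      have h5 : s₁ * A t ^ 2 ≤ s₁ * m ^ 2 := by gcongr
      have h6 : 0 ≤ v t ^ 2 := sq_nonneg _
      have h7 : 0 ≤ s₂ * A t ^ 4 := by positivity
      simp only [E]; linarith
  let D : ℝ := s₁ * m + s₂ * m ^ 3 + s₃ * M
  have hD : 0 ≤ D := by positivity
  have hvD : ∀ t, |s₁ * A t - s₂ * A t ^ 3 - s₃ * v t| ≤ D := by
    intro t
    refine (abs_sub _ _).trans (add_le_add ((abs_sub _ _).trans ?_) ?_)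
    · rw [abs_mul, abs_mul, abs_pow, abs_of_pos h1, abs_of_pos h2]
      have := hAm t
      gcongr
    · rw [abs_mul, abs_of_pos h3]
      have := hvM t
      gcongr
  have hAU : UniformContinuous A :=
    (lipschitzWith_of_forall_hasDerivAt (C := ⟨M, hM⟩) hA hvM).uniformContinuous
  have hvU : UniformContinuous v :=
    (lipschitzWith_of_forall_hasDerivAt (C := ⟨D, hD⟩) hv hvD).uniformContinuous
  have hcomp : ∀ {f u : ℝ → ℝ} {b : ℝ}, Continuous f → UniformContinuous u → (∀ t, |u t| ≤ b) →
      UniformContinuous fun t => f (u t) := fun hf hu hb =>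
    uniformContinuousOn_univ.mp <|
      ((isCompact_Icc.uniformContinuousOn_of_continuous hf.continuousOn).comp
        hu.uniformContinuousOn fun t _ => abs_le.mp (hb t))
  have hvsq : Tendsto (fun t => v t ^ 2) atTop (𝓝 0) := by
    have := tendsto_deriv_zero_of_uniformContinuous hE
      (hcomp (f := fun x => -(s₃ * x ^ 2)) (by fun_prop) hvU hvM) hl
    have := this.const_mul (-s₃⁻¹)
    rw [mul_zero] at this
    refine this.congr fun t => ?_
    field_simp
  have hvtop : Tendsto v atTop (𝓝 0) := by
    rw [tendsto_zero_iff_abs_tendsto_zero]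
    have := hvsq.sqrt
    rw [Real.sqrt_zero] at this
    exact this.congr fun t => Real.sqrt_sq_eq_abs _
  have hcubic : Tendsto (fun t => s₁ * A t - s₂ * A t ^ 3) atTop (𝓝 0) := by
    have hU : UniformContinuous fun t => s₁ * A t - s₂ * A t ^ 3 - s₃ * v t :=
      (hcomp (f := fun x => s₁ * x - s₂ * x ^ 3) (by fun_prop) hAU hAm).sub (hvU.const_mul' s₃)
    have := (tendsto_deriv_zero_of_uniformContinuous hv hU hvtop).add (hvtop.const_mul s₃)
    simpa using this
  let κ : ℝ := √(-(2 * E 0) / s₁)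
  have hκ : 0 < κ := Real.sqrt_pos.mpr (div_pos (by linarith) h1)
  have hAκ : ∀ t, 0 ≤ t → κ ≤ |A t| := by
    intro t ht
    refine Real.sqrt_le_iff.mpr ⟨abs_nonneg _, ?_⟩
    rw [sq_abs, div_le_iff₀ h1]
    have h4 : E t ≤ E 0 := hEanti ht
    have h5 : 0 ≤ s₂ * A t ^ 4 := by positivity
    have h6 : 0 ≤ v t ^ 2 := sq_nonneg _
    have h7 : E t = v t ^ 2 / 2 - s₁ * A t ^ 2 / 2 + s₂ * A t ^ 4 / 4 := rfl
    linarith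
  have hApos : ∀ t, 0 ≤ t → 0 < A t := by
    intro t ht
    by_contra! hneg
    obtain ⟨r, hr, hr0⟩ := intermediate_value_Icc' ht hAc.continuousOn
      ⟨hneg, (hpos 0 le_rfl).1.le⟩
    have := hAκ r hr.1
    rw [hr0, abs_zero] at this
    exact absurd hκ (not_lt.mpr this)
  refine ⟨?_, hvtop⟩
  rw [tendsto_iff_norm_sub_tendsto_zero]
  have hlim := hcubic.abs.div_const (s₂ * κ * q)
  rw [abs_zero, zero_div] at hlim
  refine squeeze_zero' (.of_forall fun _ => norm_nonneg _) ?_ hlim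
  filter_upwards [eventually_ge_atTop 0] with t ht
  have hp := hApos t ht
  have hk := hAκ t ht
  rw [abs_of_pos hp] at hk
  have heq : s₁ * A t - s₂ * A t ^ 3 = -(s₂ * A t * (A t + q) * (A t - q)) := by rw [hs]; ring
  rw [le_div_iff₀ (by positivity), heq, abs_neg, abs_mul, Real.norm_eq_abs, mul_comm,
    abs_of_pos (by positivity : 0 < s₂ * A t * (A t + q))]
  gcongr
  linarith

/-- Existence of a heteroclinic orbit (transition front profile) of the damped
truncated amplitude equation `A'' + s₃A' = s₁A − s₂A³`, connecting the trivial
equilibrium to the nontrivial equilibrium `(sqrt(s₁/s₂), 0)`. -/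
theorem stmt_19 (s1 s2 s3 : ℝ) (h1 : 0 < s1) (h2 : 0 < s2) (h3 : 0 < s3) :
    ∃ A : ℝ → ℝ, ContDiff ℝ 2 A ∧ (¬ ∃ c : ℝ, ∀ t : ℝ, A t = c) ∧
      (∀ t : ℝ, deriv (deriv A) t + s3 * deriv A t = s1 * A t - s2 * (A t) ^ 3) ∧
      Tendsto (fun t : ℝ => (A t, deriv A t)) atBot (nhds ((0 : ℝ), (0 : ℝ))) ∧
      Tendsto (fun t : ℝ => (A t, deriv A t)) atTop (nhds (Real.sqrt (s1 / s2), (0 : ℝ))) := by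
  have hq : 0 < √(s1 / s2) := Real.sqrt_pos.mpr (div_pos h1 h2)
  have hs : s1 = s2 * √(s1 / s2) ^ 2 := by
    rw [Real.sq_sqrt (div_pos h1 h2).le, mul_div_cancel₀ _ h2.ne']
  obtain ⟨A, v, m, M, hA, hv, hAm, hvM, hpos, hA0, hv0⟩ := exists_unstable_orbit h2 h3 hq hs
  obtain ⟨hAq, hvtop⟩ := tendsto_equilibrium h2 h3 hq hs hA hv hAm hvM hpos hA0 hv0
  have hderiv : deriv A = v := funext fun t => (hA t).deriv
  have hAc : Continuous A := continuous_iff_continuousAt.mpr fun t => (hA t).continuousAt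
  have hvc : Continuous v := continuous_iff_continuousAt.mpr fun t => (hv t).continuousAt
  refine ⟨A, ?_, ?_, fun t => ?_, ?_, ?_⟩
  · have hdv : deriv v = fun t => s1 * A t - s2 * A t ^ 3 - s3 * v t :=
      funext fun t => (hv t).deriv
    have hv1 : ContDiff ℝ 1 v := contDiff_one_iff_deriv.mpr
      ⟨fun t => (hv t).differentiableAt, by rw [hdv]; fun_prop⟩
    rw [show (2 : WithTop ℕ∞) = 1 + 1 by norm_num, contDiff_succ_iff_deriv, hderiv]
    exact ⟨fun t => (hA t).differentiableAt, by simp, hv1⟩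
  · rintro ⟨c, hc⟩
    have : A = fun _ => c := funext hc
    rw [this] at hA0 hAq
    exact hq.ne ((tendsto_nhds_unique tendsto_const_nhds hA0).symm.trans
      (tendsto_nhds_unique tendsto_const_nhds hAq))
  · rw [hderiv, (hv t).deriv]; ring
  · rw [hderiv]; exact hA0.prodMk_nhds hv0
  · rw [hderiv]; exact hAq.prodMk_nhds hvtop
end
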